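/- Let M > 0, H ≤ 0, r̂ ∈ (0, 2M), and set c := k̃(H, r̂) where k̃(H,r) := −H r³ + r^{3/2}(2M − r)^{1/2}. Suppose the r-derivative ∂k̃/∂r(H, r̂) = −3H r̂² + r̂^{1/2}(3M − 2r̂)/(2M − r̂)^{1/2} is nonzero. Then there exists r₀ ∈ (0, 2M), lying on the side of r̂ where k̃(H, ·) < c, such that l(x) := (Hx + c/x²)·√(x/(2M − x)) > 1 for all x strictly between r₀ and r̂, and the improper integral of x ↦ l(x)/((2M−x)/x · √(l(x)² − 1)) over the interval between r₀ and r̂ is finite. -/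

import Mathlib

open Real Filter Set MeasureTheory

open scoped Topology

theorem rpow_three_halves {x : ℝ} (hx : 0 < x) : x ^ ((3:ℝ)/2) = x * Real.sqrt x := by
  rw [show (3:ℝ)/2 = 1 + 1/2 by norm_num, Real.rpow_add hx, Real.rpow_one, Real.sqrt_eq_rpow]

theorem integrableOn_uIoo_abs_sub_rpow {p : ℝ} (hp : -1 < p) (a b : ℝ) :
    IntegrableOn (fun x : ℝ => |x - a| ^ p) (Set.uIoo b a) := by
  suffices h : IntervalIntegrable (fun x : ℝ => |x - a| ^ p) volume b a from
    h.def'.mono_set (by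
      rw [Set.uIoo, Set.uIoc]
      exact Set.Ioo_subset_Ioc_self)
  rcases le_total a b with hab | hab
  · have h := (intervalIntegral.intervalIntegrable_rpow' (a := 0) (b := b - a) hp).comp_sub_right a
    simp only [zero_add, sub_add_cancel] at h
    refine h.symm.congr fun x hx => ?_
    rw [Set.uIoc_of_ge hab] at hx
    simp only [abs_of_nonneg (sub_nonneg.2 hx.1.le)]
  · have h := (intervalIntegral.intervalIntegrable_rpow' (a := 0) (b := a - b) hp).comp_sub_left a
    simp only [sub_zero, sub_sub_cancel] at h
    refine h.symm.congr fun x hx => ?_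
    rw [Set.uIoc_of_le hab] at hx
    simp only [abs_of_nonpos (sub_nonpos.2 hx.2), neg_sub]

theorem exists_uIoo_forall_of_eventually {P : ℝ → Prop} {a d : ℝ} (hd : d ≠ 0)
    (hP : ∀ᶠ x in 𝓝 a, P x) :
    ∃ b, b ≠ a ∧ P b ∧ ∀ x ∈ Set.uIoo b a, P x ∧ 0 < d * (x - a) := by
  obtain ⟨ε, hε, h⟩ := Metric.eventually_nhds_iff.1 hP
  rcases hd.lt_or_gt with hd | hd
  · refine ⟨a - ε / 2, by linarith, h ?_, fun x hx => ?_⟩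
    · rw [Real.dist_eq, abs_lt]; constructor <;> linarith
    · rw [Set.uIoo_of_le (by linarith)] at hx
      refine ⟨h ?_, mul_pos_of_neg_of_neg hd (by linarith [hx.2])⟩
      rw [Real.dist_eq, abs_lt]; constructor <;> linarith [hx.1, hx.2]
  · refine ⟨a + ε / 2, by linarith, h ?_, fun x hx => ?_⟩
    · rw [Real.dist_eq, abs_lt]; constructor <;> linarith
    · rw [Set.uIoo_of_ge (by linarith)] at hx
      refine ⟨h ?_, mul_pos hd (by linarith [hx.1])⟩
      rw [Real.dist_eq, abs_lt]; constructor <;> linarith [hx.1, hx.2]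

theorem hasDerivAt_cmcBarrier {M H r : ℝ} (hr : r ∈ Set.Ioo (0:ℝ) (2*M)) :
    HasDerivAt (fun x => -H * x^3 + x ^ ((3:ℝ)/2) * Real.sqrt (2*M - x))
      (-3*H*r^2 + Real.sqrt r * (3*M - 2*r) / Real.sqrt (2*M - r)) r := by
  have hpos : 0 < 2*M - r := sub_pos.2 hr.2
  have h₁ := (hasDerivAt_pow 3 r).const_mul (-H)
  have h₂ := Real.hasDerivAt_rpow_const (x := r) (p := (3:ℝ)/2) (Or.inl hr.1.ne')
  have h₃ := ((hasDerivAt_id r).const_sub (2*M)).sqrt hpos.ne'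
  refine (h₁.add (h₂.mul h₃)).congr_deriv ?_
  have hv := Real.sqrt_pos.2 hpos
  have hvv := Real.sq_sqrt hpos.le
  rw [rpow_three_halves hr.1, show (3:ℝ)/2 - 1 = 1/2 by norm_num, ← Real.sqrt_eq_rpow]
  simp only [id]
  field_simp
  push_cast
  linear_combination (3 * Real.sqrt r) * hvv

theorem cmcSlope_sub_one {M H c x : ℝ} (hx : x ∈ Set.Ioo (0:ℝ) (2*M)) :
    (H*x + c/x^2) * Real.sqrt (x/(2*M - x)) - 1 =
      Real.sqrt (x/(2*M - x)) / x^2 *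
        (c - (-H * x^3 + x ^ ((3:ℝ)/2) * Real.sqrt (2*M - x))) := by
  have hx0 := hx.1
  have hpos : 0 < 2*M - x := sub_pos.2 hx.2
  have hv := Real.sqrt_pos.2 hpos
  have huu := Real.sq_sqrt hx.1.le
  rw [rpow_three_halves hx.1, Real.sqrt_div hx.1.le]
  field_simp
  linear_combination x * Real.sqrt (2*M - x) * huu

/-- Near a point `r̂` where `k̃(H, r̂) = c` and `∂k̃/∂r (H, r̂) ≠ 0`, there is an interval
on the side where `k̃(H,·) < c` (equivalently `l > 1`) over which the SS-CMC integrand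
`l/(-h √(l² - 1))` is integrable, so the SS-CMC solution extends to a finite value at `r̂`. -/
theorem stmt13 (M H : ℝ) (hM : 0 < M) (hH : H ≤ 0) (rhat : ℝ)
    (hr : rhat ∈ Set.Ioo (0:ℝ) (2*M)) (c : ℝ)
    (hc : c = -H * rhat^3 + rhat ^ ((3:ℝ)/2) * Real.sqrt (2*M - rhat))
    (hderiv : -3*H*rhat^2 + Real.sqrt rhat * (3*M - 2*rhat) / Real.sqrt (2*M - rhat) ≠ 0)
    (l : ℝ → ℝ)
    (hl : ∀ x, l x = (H*x + c/x^2) * Real.sqrt (x/(2*M - x))) :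
    ∃ r₀ ∈ Set.Ioo (0:ℝ) (2*M), r₀ ≠ rhat ∧
      (∀ x ∈ Set.uIoo r₀ rhat,
        -H * x^3 + x ^ ((3:ℝ)/2) * Real.sqrt (2*M - x) < c) ∧
      (∀ x ∈ Set.uIoo r₀ rhat, 1 < l x) ∧
      IntegrableOn
        (fun x => l x / (((2*M - x)/x) * Real.sqrt ((l x)^2 - 1)))
        (Set.uIoo r₀ rhat) := by
  obtain rfl : l = fun x => (H*x + c/x^2) * Real.sqrt (x/(2*M - x)) := funext hl
  set k : ℝ → ℝ := fun x => -H * x^3 + x ^ ((3:ℝ)/2) * Real.sqrt (2*M - x)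
  set l : ℝ → ℝ := fun x => (H*x + c/x^2) * Real.sqrt (x/(2*M - x))
  set w : ℝ → ℝ := fun x => Real.sqrt (x/(2*M - x)) / x^2
  have hr0 : rhat ≠ 0 := hr.1.ne'
  have hr2 : 0 < 2*M - rhat := sub_pos.2 hr.2
  have hkd : HasDerivAt k _ rhat := hasDerivAt_cmcBarrier hr
  have hkc : k rhat = c := hc.symm
  set D := -3*H*rhat^2 + Real.sqrt rhat * (3*M - 2*rhat) / Real.sqrt (2*M - rhat)
  have hD : 0 < |D| := abs_pos.2 hderiv
  have hlin : ∀ᶠ x in 𝓝 rhat, |k x - c - D * (x - rhat)| ≤ |D| / 2 * |x - rhat| := by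
    filter_upwards [hkd.isLittleO.def (half_pos hD)] with x hx
    simpa [hkc, mul_comm] using hx
  have hsc : ContinuousAt (fun x => Real.sqrt (x/(2*M - x))) rhat :=
    (continuousAt_id.div (by fun_prop) hr2.ne').sqrt
  have hwc : ContinuousAt w rhat := hsc.div (continuousAt_id.pow 2) (pow_ne_zero 2 hr0)
  have hwpos : 0 < w rhat :=
    div_pos (Real.sqrt_pos.2 (div_pos hr.1 hr2)) (pow_pos hr.1 2)
  have hlc : ContinuousAt l rhat :=
    ((by fun_prop : ContinuousAt (fun x => H*x) rhat).add
      (continuousAt_const.div (continuousAt_id.pow 2) (pow_ne_zero 2 hr0))).mul hsc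
  have hqc : ContinuousAt (fun x => l x / ((2*M - x)/x)) rhat :=
    hlc.div ((by fun_prop : ContinuousAt (fun x => 2*M - x) rhat).div continuousAt_id hr0)
      (div_ne_zero hr2.ne' hr0)
  set B := l rhat / ((2*M - rhat)/rhat) + 1
  set m := w rhat / 2
  have hm : 0 < m := half_pos hwpos
  obtain ⟨r₀, hne, ⟨hmem, -⟩, hall⟩ := exists_uIoo_forall_of_eventually (neg_ne_zero.2 hderiv)
    ((isOpen_Ioo.eventually_mem hr).and (hlin.and
      ((hwc.eventually (lt_mem_nhds (half_lt_self hwpos))).and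
        (hqc.eventually (gt_mem_nhds (lt_add_one _))))))
  have hgap : ∀ x ∈ Set.uIoo r₀ rhat, |D| / 2 * |x - rhat| ≤ c - k x := by
    intro x hx
    obtain ⟨⟨-, hx₁, -⟩, hx₂⟩ := hall x hx
    have h₁ : |D| * |x - rhat| = -D * (x - rhat) := by
      rw [← abs_neg D, ← abs_mul, abs_of_pos hx₂]
    linarith [(abs_le.1 hx₁).2]
  have hne' : ∀ x ∈ Set.uIoo r₀ rhat, 0 < |x - rhat| := fun x hx =>
    abs_pos.2 fun h => by simpa [h] using (hall x hx).2
  have hlt : ∀ x ∈ Set.uIoo r₀ rhat, k x < c := fun x hx =>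
    sub_pos.1 ((mul_pos (half_pos hD) (hne' x hx)).trans_le (hgap x hx))
  have hl1 : ∀ x ∈ Set.uIoo r₀ rhat, m * (|D| / 2) * |x - rhat| ≤ l x - 1 := by
    intro x hx
    obtain ⟨⟨hxI, -, hx₁, -⟩, -⟩ := hall x hx
    have h : l x - 1 = w x * (c - k x) := cmcSlope_sub_one hxI
    rw [h, mul_assoc]
    exact mul_le_mul hx₁.le (hgap x hx) (by positivity) (hm.trans hx₁).le
  have hA : 0 < m * (|D| / 2) := mul_pos hm (half_pos hD)
  have hl2 : ∀ x ∈ Set.uIoo r₀ rhat, 1 < l x := fun x hx =>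
    sub_pos.1 ((mul_pos hA (hne' x hx)).trans_le (hl1 x hx))
  refine ⟨r₀, hmem, hne, hlt, hl2, ?_⟩
  have hint := (integrableOn_uIoo_abs_sub_rpow (p := -(1/2)) (by norm_num) rhat r₀).const_mul
    (B * (m * (|D| / 2)) ^ (-(1/2) : ℝ))
  have hmeas : MeasurableSet (Set.uIoo r₀ rhat) := measurableSet_Ioo
  refine Integrable.mono' hint ?_ ((ae_restrict_iff' hmeas).2 (Eventually.of_forall fun x hx => ?_))
  · apply Measurable.aestronglyMeasurable
    fun_prop
  · obtain ⟨⟨hxI, -, -, hxB⟩, -⟩ := hall x hx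
    have hl0 : 0 < l x := one_pos.trans (hl2 x hx)
    have hq : 0 < l x / ((2*M - x)/x) :=
      div_pos hl0 (div_pos (sub_pos.2 hxI.2) hxI.1)
    have hpos := mul_pos hA (hne' x hx)
    have hsq : m * (|D| / 2) * |x - rhat| ≤ (l x)^2 - 1 := by
      nlinarith [hl1 x hx, hl2 x hx]
    rw [← div_div, Real.norm_of_nonneg (div_nonneg hq.le (Real.sqrt_nonneg _)), mul_assoc,
      ← Real.mul_rpow hA.le (abs_nonneg _), Real.rpow_neg hpos.le, ← Real.sqrt_eq_rpow,
      div_eq_mul_inv]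
    exact mul_le_mul hxB.le (inv_anti₀ (Real.sqrt_pos.2 hpos) (Real.sqrt_le_sqrt hsq))
      (inv_nonneg.2 (Real.sqrt_nonneg _)) (hq.trans hxB).le
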